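/- Let ρ₁, ρ₂, ρ₃ be forcing functions, μ_k > 0 with μ_k → 0, and let x_k ∈ E, z_k ∈ ℝ^m satisfy for every k: ‖∇_x L(x_k,z_k)‖ ≤ ρ₁(μ_k), (Σ_{i=1}^m ((z_k)_i g_i(x_k) − μ_k)²)^{1/2} ≤ ρ₂(μ_k), λ_min[H(x_k,z_k)] ≥ −ρ₃(μ_k), g_i(x_k) > 0 and (z_k)_i > 0 for all i; suppose x_k → x* ∈ E, the family (∇g_i(x*))_{i∈A(x*)} is linearly independent where A(x*) = {i : g_i(x*) = 0}, and there exist c, r > 0 with ‖Hess f(x) − Hess f(x*)‖_op ≤ c‖x − x*‖ and ‖Hess g_i(x) − Hess g_i(x*)‖_op ≤ c‖x − x*‖ for all i and all ‖x − x*‖ ≤ r. Then there exists z* ∈ ℝ^m with z*_i ≥ 0 satisfying the KKT conditions at (x*,z*) (∇_x L(x*,z*) = 0, g_i(x*) ≥ 0, z*_i g_i(x*) = 0 for all i), and such that if strict complementarity holds at (x*,z*) (for each i exactly one of z*_i and g_i(x*) is zero), then x* satisfies the second-order necessary condition: ⟨Hess_x L(x*,z*)v, v⟩ ≥ 0 for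 every v in the critical cone C(x*,z*) = {v ∈ E : ⟨∇g_i(x*),v⟩ = 0 for all i ∈ A(x*) with z*_i > 0, and ⟨∇g_i(x*),v⟩ ≥ 0 for all i ∈ A(x*) with z*_i = 0}. -/

import Mathlib

open Filter Topology
open scoped RealInnerProductSpace BigOperators

noncomputable section

variable {E : Type*} [NormedAddCommGroup E] [InnerProductSpace ℝ E] [FiniteDimensional ℝ E]

/-- A forcing function: continuous on `[0,∞)`, nonnegative there, vanishing exactly at `0`. -/
def IsForcing (ρ : ℝ → ℝ) : Prop :=
  ContinuousOn ρ (Set.Ici 0) ∧ (∀ t, 0 ≤ t → 0 ≤ ρ t) ∧ ∀ t, 0 ≤ t → (ρ t = 0 ↔ t = 0)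

/-- The Hessian of `h` at `x`, i.e. the derivative of the gradient field of `h` at `x`. -/
def Hess (h : E → ℝ) (x : E) : E →L[ℝ] E := fderiv ℝ (gradient h) x

/-- Gradient of the Lagrangian `L(x,z) = f(x) - ∑ i, z i * g i x` with respect to `x`. -/
def gradL {m : ℕ} (f : E → ℝ) (g : Fin m → E → ℝ) (x : E) (z : Fin m → ℝ) : E :=
  gradient f x - ∑ i, z i • gradient (g i) x

/-- Hessian of the Lagrangian with respect to `x`. -/
def hessL {m : ℕ} (f : E → ℝ) (g : Fin m → E → ℝ) (x : E) (z : Fin m → ℝ) : E →L[ℝ] E :=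
  Hess f x - ∑ i, z i • Hess (g i) x

/-- The condensed primal-dual operator `H(x,z)`,
`H(x,z) v = Hess_x L(x,z) v + ∑ i (z i / g i x) ⟪∇g i x, v⟫ ∇g i x`. -/
def Hxz {m : ℕ} (f : E → ℝ) (g : Fin m → E → ℝ) (x : E) (z : Fin m → ℝ) : E →L[ℝ] E :=
  hessL f g x z +
    ∑ i, (z i / g i x) • ((innerSL ℝ (gradient (g i) x)).smulRight (gradient (g i) x))

/-- Smallest Rayleigh-quotient value of `A` over the unit sphere. -/
def lamMin (A : E →L[ℝ] E) : ℝ := sInf ((fun v => ⟪A v, v⟫) '' {v : E | ‖v‖ = 1})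

/-- The log-barrier merit function `φ_μ`. -/
def barrierPhi {m : ℕ} (μ : ℝ) (f : E → ℝ) (g : Fin m → E → ℝ) (x : E) : ℝ :=
  f x - μ * ∑ i, Real.log (g i x)

/-- The barrier gradient `q_μ(x) = ∇f(x) - μ ∑ i ∇g i (x) / g i x`. -/
def qmu {m : ℕ} (μ : ℝ) (f : E → ℝ) (g : Fin m → E → ℝ) (x : E) : E :=
  gradient f x - μ • ∑ i, (g i x)⁻¹ • gradient (g i) x

/-- Trust-region model `m_{x,z,μ}(d)`. -/
def trModel {m : ℕ} (μ : ℝ) (f : E → ℝ) (g : Fin m → E → ℝ) (x : E) (z : Fin m → ℝ)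
    (d : E) : ℝ :=
  (1/2) * ⟪Hxz f g x z d, d⟫ + ⟪qmu μ f g x, d⟫

/-- Predicted reduction of the step `d`. -/
def predRed {m : ℕ} (μ : ℝ) (f : E → ℝ) (g : Fin m → E → ℝ) (x : E) (z : Fin m → ℝ)
    (d : E) : ℝ :=
  - trModel μ f g x z d

/-- Actual reduction of the step `d`. -/
def aredRed {m : ℕ} (μ : ℝ) (f : E → ℝ) (g : Fin m → E → ℝ) (x : E) (d : E) : ℝ :=
  barrierPhi μ f g x - barrierPhi μ f g (x + d)


/-- A linearly independent limit of families of vectors admits convergent dual families. -/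
theorem LinearIndependent.exists_tendsto_dual_family
    {ι α F : Type*} [Fintype ι] [DecidableEq ι] [NormedAddCommGroup F] [InnerProductSpace ℝ F]
    {l : Filter α} {a : α → ι → F} {b : ι → F}
    (hab : ∀ i, Tendsto (fun k => a k i) l (𝓝 (b i))) (hb : LinearIndependent ℝ b) :
    ∃ (w : α → ι → F) (u : ι → F), (∀ i, Tendsto (fun k => w k i) l (𝓝 (u i))) ∧
      ∀ᶠ k in l, ∀ i j, ⟪a k i, w k j⟫ = if i = j then 1 else 0 := by
  have hdet : (Matrix.gram ℝ b).det ≠ 0 := Matrix.det_gram_ne_zero_iff_linearIndependent.2 hb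
  have hgram : Tendsto (fun k => Matrix.gram ℝ (a k)) l (𝓝 (Matrix.gram ℝ b)) :=
    tendsto_pi_nhds.2 fun i => tendsto_pi_nhds.2 fun j => (hab i).inner (hab j)
  have hinv : Tendsto (fun k => (Matrix.gram ℝ (a k))⁻¹) l (𝓝 (Matrix.gram ℝ b)⁻¹) := by
    refine (continuousAt_matrix_inv _ ?_).tendsto.comp hgram
    simpa using continuousAt_inv₀ hdet
  have hdet_ev : ∀ᶠ k in l, (Matrix.gram ℝ (a k)).det ≠ 0 :=
    ((continuous_id.matrix_det.tendsto _).comp hgram).eventually_ne hdet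
  refine ⟨fun k j => ∑ i, (Matrix.gram ℝ (a k))⁻¹ i j • a k i,
    fun j => ∑ i, (Matrix.gram ℝ b)⁻¹ i j • b i, fun j => ?_, ?_⟩
  · exact tendsto_finsetSum _ fun i _ =>
      ((tendsto_pi_nhds.1 ((tendsto_pi_nhds.1 hinv) i)) j).smul (hab i)
  · filter_upwards [hdet_ev] with k hk i j
    rw [← Matrix.one_apply, ← Matrix.mul_nonsing_inv _ (isUnit_iff_ne_zero.2 hk),
      Matrix.mul_apply, inner_sum]
    simp [inner_smul_right, mul_comm]

/-- A vector orthogonal to a linearly independent limit family is a limit of vectors orthogonal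
to the approximating families. -/
theorem LinearIndependent.exists_tendsto_inner_eq_zero
    {ι α F : Type*} [Fintype ι] [NormedAddCommGroup F] [InnerProductSpace ℝ F]
    {l : Filter α} {a : α → ι → F} {b : ι → F}
    (hab : ∀ i, Tendsto (fun k => a k i) l (𝓝 (b i))) (hb : LinearIndependent ℝ b)
    {v : F} (hv : ∀ i, ⟪b i, v⟫ = 0) :
    ∃ y : α → F, Tendsto y l (𝓝 v) ∧ ∀ᶠ k in l, ∀ i, ⟪a k i, y k⟫ = 0 := by
  classical
  obtain ⟨w, u, hw, hdual⟩ := hb.exists_tendsto_dual_family hab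
  refine ⟨fun k => v - ∑ j, ⟪a k j, v⟫ • w k j, ?_, ?_⟩
  · have h : Tendsto (fun k => v - ∑ j, ⟪a k j, v⟫ • w k j) l
        (𝓝 (v - ∑ j, ⟪b j, v⟫ • u j)) :=
      tendsto_const_nhds.sub <| tendsto_finsetSum _ fun j _ =>
        ((hab j).inner tendsto_const_nhds).smul (hw j)
    simpa [hv] using h
  · filter_upwards [hdual] with k hk i
    simp [inner_sub_right, inner_sum, inner_smul_right, hk]

/-- The coefficients of a convergent linear combination over families with a linearly independent
limit converge. -/
theorem LinearIndependent.exists_tendsto_coeff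
    {ι α F : Type*} [Fintype ι] [NormedAddCommGroup F] [InnerProductSpace ℝ F]
    {l : Filter α} {a : α → ι → F} {b : ι → F}
    (hab : ∀ i, Tendsto (fun k => a k i) l (𝓝 (b i))) (hb : LinearIndependent ℝ b)
    {t : α → ι → ℝ} {s : F} (hs : Tendsto (fun k => ∑ i, t k i • a k i) l (𝓝 s)) :
    ∃ τ : ι → ℝ, ∀ i, Tendsto (fun k => t k i) l (𝓝 (τ i)) := by
  classical
  obtain ⟨w, u, hw, hdual⟩ := hb.exists_tendsto_dual_family hab
  refine ⟨fun i => ⟪s, u i⟫, fun i => (hs.inner (hw i)).congr' ?_⟩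
  filter_upwards [hdual] with k hk
  simp [sum_inner, real_inner_smul_left, hk]

theorem IsForcing.tendsto_comp {ρ : ℝ → ℝ} (hρ : IsForcing ρ) {α : Type*} {l : Filter α}
    {μ : α → ℝ} (hμpos : ∀ k, 0 < μ k) (hμ : Tendsto μ l (𝓝 0)) :
    Tendsto (fun k => ρ (μ k)) l (𝓝 0) := by
  have h := (hρ.1 0 Set.self_mem_Ici).tendsto
  rw [(hρ.2.2 0 le_rfl).2 rfl] at h
  exact h.comp (tendsto_nhdsWithin_iff.2 ⟨hμ, Eventually.of_forall fun k => (hμpos k).le⟩)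

theorem lamMin_mul_norm_sq_le_inner {F : Type*} [NormedAddCommGroup F] [InnerProductSpace ℝ F]
    (A : F →L[ℝ] F) (v : F) :
    lamMin A * ‖v‖ ^ 2 ≤ ⟪A v, v⟫ := by
  rcases eq_or_ne v 0 with rfl | hv
  · simp
  have hn : ‖v‖ ≠ 0 := norm_ne_zero_iff.2 hv
  have hbdd : BddBelow ((fun v => ⟪A v, v⟫) '' {v : F | ‖v‖ = 1}) := by
    refine ⟨-‖A‖, ?_⟩
    rintro _ ⟨y, hy, rfl⟩
    have h1 := (abs_le.1 (abs_real_inner_le_norm (A y) y)).1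
    have h2 := A.le_opNorm y
    rw [Set.mem_ofPred_eq] at hy
    rw [hy, mul_one] at h1 h2
    exact (neg_le_neg h2).trans h1
  have h : lamMin A ≤ ⟪A (‖v‖⁻¹ • v), ‖v‖⁻¹ • v⟫ :=
    csInf_le hbdd ⟨_, by simp [norm_smul, hn], rfl⟩
  rw [map_smul, real_inner_smul_left, real_inner_smul_right] at h
  calc lamMin A * ‖v‖ ^ 2 ≤ ‖v‖⁻¹ * (‖v‖⁻¹ * ⟪A v, v⟫) * ‖v‖ ^ 2 := by gcongr
    _ = ⟪A v, v⟫ := by field_simp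

theorem ContDiff.gradient {h : E → ℝ} (hh : ContDiff ℝ 2 h) : ContDiff ℝ 1 (gradient h) :=
  (InnerProductSpace.toDual ℝ E).symm.contDiff.comp (hh.fderiv_right (by norm_num))

theorem ContDiff.continuous_Hess {h : E → ℝ} (hh : ContDiff ℝ 2 h) : Continuous (Hess h) :=
  hh.gradient.continuous_fderiv (by norm_num)

theorem inner_Hxz {m : ℕ} (f : E → ℝ) (g : Fin m → E → ℝ) (x : E) (z : Fin m → ℝ) (v : E) :
    ⟪Hxz f g x z v, v⟫ =
      ⟪hessL f g x z v, v⟫ + ∑ i, z i / g i x * ⟪gradient (g i) x, v⟫ ^ 2 := by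
  simp [Hxz, inner_add_left, sum_inner, real_inner_smul_left, pow_two]

/-- If the multipliers of the inactive constraints vanish in the limit and the constraint
gradients are linearly independent, asymptotically stationary multipliers converge. -/
theorem exists_tendsto_multipliers {m : ℕ} {f : E → ℝ} {g : Fin m → E → ℝ}
    (hf : ContDiff ℝ 2 f) (hg : ∀ i, ContDiff ℝ 2 (g i)) {α : Type*} {l : Filter α}
    {x : α → E} {z : α → Fin m → ℝ} {xs : E} (hx : Tendsto x l (𝓝 xs))
    (hL : Tendsto (fun k => gradL f g (x k) (z k)) l (𝓝 0))
    (hz : ∀ i, g i xs ≠ 0 → Tendsto (fun k => z k i) l (𝓝 0))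
    (hLICQ : LinearIndependent ℝ (fun i : {i : Fin m // g i xs = 0} => gradient (g i.1) xs)) :
    ∃ zs : Fin m → ℝ, Tendsto z l (𝓝 zs) := by
  classical
  have hgrad (i : Fin m) : Tendsto (fun k => gradient (g i) (x k)) l (𝓝 (gradient (g i) xs)) :=
    ((hg i).gradient.continuous.tendsto xs).comp hx
  have hinactive : Tendsto (fun k => ∑ i : {i : Fin m // g i xs ≠ 0},
      z k i • gradient (g i) (x k)) l (𝓝 0) := by
    simpa using tendsto_finsetSum Finset.univ
      fun (i : {i : Fin m // g i xs ≠ 0}) _ => (hz i i.2).smul (hgrad i)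
  have hactive : Tendsto (fun k => ∑ i : {i : Fin m // g i xs = 0},
      z k i • gradient (g i) (x k)) l (𝓝 (gradient f xs - 0 - 0)) := by
    refine (((hf.gradient.continuous.tendsto xs).comp hx).sub hL |>.sub hinactive).congr
      fun k => ?_
    have := Fintype.sum_subtype_add_sum_subtype (fun i => g i xs = 0)
      (fun i => z k i • gradient (g i) (x k))
    simp only [gradL, ← this, Function.comp_apply]
    abel
  obtain ⟨t, ht⟩ := hLICQ.exists_tendsto_coeff (t := fun k i => z k i)
    (a := fun k (i : {i : Fin m // g i xs = 0}) => gradient (g i.1) (x k)) (fun i => hgrad i) hactive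
  refine ⟨fun i => if h : g i xs = 0 then t ⟨i, h⟩ else 0,
    tendsto_pi_nhds.2 fun i => ?_⟩
  split_ifs with h
  · exact ht ⟨i, h⟩
  · exact hz i h

/-- Under LICQ and local Lipschitzness of the Hessians, the limit of the
outer iterates is a KKT point, and under strict complementarity it satisfies the
second-order necessary condition on the critical cone. -/
theorem outer_limit_is_SOSP_under_SC
    {E : Type*} [NormedAddCommGroup E] [InnerProductSpace ℝ E] [FiniteDimensional ℝ E]
    [Nontrivial E] {m : ℕ} (hm : 1 ≤ m)
    (f : E → ℝ) (g : Fin m → E → ℝ)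
    (hf : ContDiff ℝ 2 f) (hg : ∀ i, ContDiff ℝ 2 (g i))
    (ρ₁ ρ₂ ρ₃ : ℝ → ℝ) (hρ₁ : IsForcing ρ₁) (hρ₂ : IsForcing ρ₂) (hρ₃ : IsForcing ρ₃)
    (μ : ℕ → ℝ) (hμpos : ∀ k, 0 < μ k) (hμ0 : Tendsto μ atTop (𝓝 0))
    (x : ℕ → E) (z : ℕ → Fin m → ℝ)
    (h1 : ∀ k, ‖gradL f g (x k) (z k)‖ ≤ ρ₁ (μ k))
    (h2 : ∀ k, Real.sqrt (∑ i, (z k i * g i (x k) - μ k) ^ 2) ≤ ρ₂ (μ k))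
    (h3 : ∀ k, -ρ₃ (μ k) ≤ lamMin (Hxz f g (x k) (z k)))
    (h4 : ∀ k i, 0 < g i (x k) ∧ 0 < z k i)
    (xs : E) (hx : Tendsto x atTop (𝓝 xs))
    -- LICQ at `xs`
    (hLICQ : LinearIndependent ℝ (fun i : {i : Fin m // g i xs = 0} => gradient (g i.1) xs))
    -- local Lipschitzness of the Hessians at `xs`
    (c r : ℝ) (hc : 0 < c) (hr : 0 < r)
    (hLipf : ∀ y : E, ‖y - xs‖ ≤ r → ‖Hess f y - Hess f xs‖ ≤ c * ‖y - xs‖)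
    (hLipg : ∀ i, ∀ y : E, ‖y - xs‖ ≤ r → ‖Hess (g i) y - Hess (g i) xs‖ ≤ c * ‖y - xs‖) :
    ∃ zs : Fin m → ℝ, (∀ i, 0 ≤ zs i) ∧
      gradL f g xs zs = 0 ∧ (∀ i, 0 ≤ g i xs) ∧ (∀ i, zs i * g i xs = 0) ∧
      -- strict complementarity implies second-order necessity on the critical cone
      ((∀ i, Xor' (zs i = 0) (g i xs = 0)) →
        ∀ v : E,
          (∀ i, g i xs = 0 → 0 < zs i → ⟪gradient (g i) xs, v⟫ = 0) →
          (∀ i, g i xs = 0 → zs i = 0 → 0 ≤ ⟪gradient (g i) xs, v⟫) →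
          0 ≤ ⟪hessL f g xs zs v, v⟫) := by
  have hgrad (i : Fin m) : Tendsto (fun k => gradient (g i) (x k)) atTop
      (𝓝 (gradient (g i) xs)) := ((hg i).gradient.continuous.tendsto xs).comp hx
  have hgx (i : Fin m) : Tendsto (fun k => g i (x k)) atTop (𝓝 (g i xs)) :=
    ((hg i).continuous.tendsto xs).comp hx
  have hL : Tendsto (fun k => gradL f g (x k) (z k)) atTop (𝓝 0) :=
    squeeze_zero_norm h1 (hρ₁.tendsto_comp hμpos hμ0)
  have hcomp (i : Fin m) : Tendsto (fun k => z k i * g i (x k)) atTop (𝓝 0) := by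
    have h : Tendsto (fun k => z k i * g i (x k) - μ k) atTop (𝓝 0) := by
      refine squeeze_zero_norm (fun k => le_trans ?_ (h2 k)) (hρ₂.tendsto_comp hμpos hμ0)
      exact Real.le_sqrt_of_sq_le <| by
        simpa using Finset.single_le_sum (f := fun j => (z k j * g j (x k) - μ k) ^ 2)
          (fun j _ => sq_nonneg _) (Finset.mem_univ i)
    simpa using h.add hμ0
  have hz (i : Fin m) (hi : g i xs ≠ 0) : Tendsto (fun k => z k i) atTop (𝓝 0) := by
    have h := (hcomp i).div (hgx i) hi
    rw [zero_div] at h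
    exact h.congr fun k => mul_div_cancel_right₀ _ (h4 k i).1.ne'
  obtain ⟨zs, hzs⟩ := exists_tendsto_multipliers hf hg hx hL hz hLICQ
  have hzi := tendsto_pi_nhds.1 hzs
  have hzs_nonneg (i : Fin m) : 0 ≤ zs i := ge_of_tendsto' (hzi i) fun k => (h4 k i).2.le
  refine ⟨zs, hzs_nonneg, ?_, fun i => ge_of_tendsto' (hgx i) fun k => (h4 k i).1.le,
    fun i => tendsto_nhds_unique ((hzi i).mul (hgx i)) (hcomp i), ?_⟩
  · refine tendsto_nhds_unique ?_ hL
    exact ((hf.gradient.continuous.tendsto xs).comp hx).sub <|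
      tendsto_finsetSum _ fun i _ => (hzi i).smul (hgrad i)
  intro hSC v hv _
  have hv_active (i : {i : Fin m // g i xs = 0}) : ⟪gradient (g i.1) xs, v⟫ = 0 :=
    hv i i.2 <| (hzs_nonneg i).lt_of_ne' fun h => (hSC i).elim (fun hx => hx.2 i.2) fun hx => hx.2 h
  obtain ⟨y, hy, hy0⟩ := hLICQ.exists_tendsto_inner_eq_zero
    (a := fun k (i : {i : Fin m // g i xs = 0}) => gradient (g i.1) (x k))
    (fun i => hgrad i) hv_active
  have hhess : Tendsto (fun k => hessL f g (x k) (z k)) atTop (𝓝 (hessL f g xs zs)) :=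
    ((hf.continuous_Hess.tendsto xs).comp hx).sub <| tendsto_finsetSum _ fun i _ =>
      (hzi i).smul (((hg i).continuous_Hess.tendsto xs).comp hx)
  have hsum : Tendsto (fun k => ∑ i, z k i / g i (x k) * ⟪gradient (g i) (x k), y k⟫ ^ 2)
      atTop (𝓝 (∑ _i : Fin m, 0)) := by
    refine tendsto_finsetSum _ fun i _ => ?_
    by_cases hi : g i xs = 0
    · refine tendsto_const_nhds.congr' ?_
      filter_upwards [hy0] with k hk
      simp [hk ⟨i, hi⟩]
    · simpa using ((hz i hi).div (hgx i) hi).mul (((hgrad i).inner hy).pow 2)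
  have happly : Tendsto (fun k => hessL f g (x k) (z k) (y k)) atTop (𝓝 (hessL f g xs zs v)) :=
    (isBoundedBilinearMap_apply.continuous.tendsto (hessL f g xs zs, v)).comp
      (hhess.prodMk_nhds hy)
  have hquad := (happly.inner hy).add hsum
  have hlow : Tendsto (fun k => -ρ₃ (μ k) * ‖y k‖ ^ 2) atTop (𝓝 (-0 * ‖v‖ ^ 2)) :=
    (hρ₃.tendsto_comp hμpos hμ0).neg.mul (hy.norm.pow 2)
  have h := le_of_tendsto_of_tendsto' hlow hquad fun k => by
    rw [← inner_Hxz]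
    exact (mul_le_mul_of_nonneg_right (h3 k) (sq_nonneg _)).trans
      (lamMin_mul_norm_sq_le_inner _ _)
  simpa using h

end
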